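/- With the noisy harmonic oscillator setup (γ, ω, σ, σ̄₁, σ̄₂ > 0; F = [[0,1],[−ω²,−γ]]; Σ = [[0,0],[0,σ]]; Q₀ = diag(σ̄₁², σ̄₂²); R(t) = ∫₀ᵗ e^{sF} Σ Σᵀ e^{sFᵀ} ds; Q(t) = e^{tF} Q₀ e^{tFᵀ} + R(t); σ_* = σ²/(2γω²)), assume the overdamped condition γ² > 4ω² and that the initial variances exceed the stationary ones: σ̄₁² > σ_* and σ̄₂² > ω² σ_*. Then t ↦ det Q(t) is strictly decreasing on [0, ∞); equivalently, the Gibbs entropy H_G(t) = 1 + log(2π) + (1/2) log det Q(t) of the Gaussian solution is strictly decreasing for all t ≥ 0. -/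

import Mathlib

open MeasureTheory Real Filter Matrix Set

section MatrixExponential

variable {n : Type*} [Fintype n] [DecidableEq n]

open scoped Matrix.Norms.Operator in
/-- The congruence flow `t ↦ e^{tF} S e^{tFᵀ}` solves the Lyapunov equation, entrywise. -/
theorem hasDerivAt_exp_smul_mul_mul_exp_smul_transpose_apply (F S : Matrix n n ℝ) (i j : n)
    (t : ℝ) :
    HasDerivAt (fun s : ℝ => (NormedSpace.exp (s • F) * S * NormedSpace.exp (s • Fᵀ)) i j)
      ((NormedSpace.exp (t • F) * (F * S + S * Fᵀ) * NormedSpace.exp (t • Fᵀ)) i j) t := by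
  have h := ((hasDerivAt_exp_smul_const (𝕂 := ℝ) F t).mul_const S).mul
    (hasDerivAt_exp_smul_const' (𝕂 := ℝ) Fᵀ t)
  refine ((hasDerivAt_pi.1 ((hasDerivAt_pi.1 h) i)) j).congr_deriv ?_
  exact congrFun (congrFun (by noncomm_ring) i) j

open scoped Matrix.Norms.Operator in
theorem hasDerivAt_exp_smul_apply (F : Matrix n n ℝ) (i j : n) (t : ℝ) :
    HasDerivAt (fun s : ℝ => NormedSpace.exp (s • F) i j)
      ((F * NormedSpace.exp (t • F)) i j) t :=
  (hasDerivAt_pi.1 ((hasDerivAt_pi.1 (hasDerivAt_exp_smul_const' (𝕂 := ℝ) F t)) i)) j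

/-- If `S` solves the stationary Lyapunov equation `F S + S Fᵀ + N = 0`, then the covariance
accumulated up to time `t` is `S - e^{tF} S e^{tFᵀ}`. -/
theorem integral_exp_smul_mul_mul_exp_smul_transpose_apply {F S N : Matrix n n ℝ}
    (h : F * S + S * Fᵀ = -N) (i j : n) (t : ℝ) :
    ∫ s in (0 : ℝ)..t, (NormedSpace.exp (s • F) * N * NormedSpace.exp (s • Fᵀ)) i j =
      (S - NormedSpace.exp (t • F) * S * NormedSpace.exp (t • Fᵀ)) i j := by
  have hderiv (s : ℝ) : HasDerivAt
      (fun s : ℝ => -(NormedSpace.exp (s • F) * S * NormedSpace.exp (s • Fᵀ)) i j)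
      ((NormedSpace.exp (s • F) * N * NormedSpace.exp (s • Fᵀ)) i j) s := by
    refine (hasDerivAt_exp_smul_mul_mul_exp_smul_transpose_apply F S i j s).neg.congr_deriv ?_
    simp [h]
  have hcont : Continuous
      (fun s : ℝ => (NormedSpace.exp (s • F) * N * NormedSpace.exp (s • Fᵀ)) i j) :=
    continuous_iff_continuousAt.2 fun s =>
      (hasDerivAt_exp_smul_mul_mul_exp_smul_transpose_apply F N i j s).continuousAt
  rw [intervalIntegral.integral_eq_sub_of_hasDerivAt (fun s _ => hderiv s)
    (hcont.intervalIntegrable 0 t)]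
  simp [NormedSpace.exp_zero]
  ring

end MatrixExponential

/-- The derivative of `det (R_* + E diag(a, b) Eᵀ)` along `E = e^{tF}`, where `F` is the drift of
the damped oscillator and `R_* = s diag(1, ω²)`. -/
theorem hasDerivAt_det_add_exp_smul_conj (γ ω s a b t : ℝ) {F : Matrix (Fin 2) (Fin 2) ℝ}
    (hF : F = !![0, 1; -ω ^ 2, -γ]) :
    HasDerivAt
      (fun t : ℝ => (!![s, 0; 0, ω ^ 2 * s] +
        NormedSpace.exp (t • F) * !![a, 0; 0, b] * NormedSpace.exp (t • Fᵀ)).det)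
      (-(2 * γ) * (s * (a * NormedSpace.exp (t • F) 1 0 ^ 2 + b * NormedSpace.exp (t • F) 1 1 ^ 2)
        + a * b * (NormedSpace.exp (t • F)).det ^ 2)) t := by
  have h00 := hasDerivAt_exp_smul_apply F 0 0 t
  have h01 := hasDerivAt_exp_smul_apply F 0 1 t
  have h10 := hasDerivAt_exp_smul_apply F 1 0 t
  have h11 := hasDerivAt_exp_smul_apply F 1 1 t
  simp only [← transpose_smul, Matrix.exp_transpose, det_fin_two]
  generalize hE : (fun r : ℝ => NormedSpace.exp (r • F)) = E at *
  have hE' (r : ℝ) : NormedSpace.exp (r • F) = E r := congrFun hE r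
  simp only [hE'] at *
  have h := (((((h00.pow 2).const_mul a).add ((h01.pow 2).const_mul b)).const_add s).mul
    ((((h10.pow 2).const_mul a).add ((h11.pow 2).const_mul b)).const_add (ω ^ 2 * s))).sub
    ((((h00.mul h10).const_mul a).add ((h01.mul h11).const_mul b)).pow 2)
  refine (h.congr_deriv ?_).congr_of_eventuallyEq (Eventually.of_forall fun r => ?_)
  · simp [hF, Matrix.mul_apply, Fin.sum_univ_two]
    ring
  · simp [Matrix.mul_apply, Fin.sum_univ_two]
    ring

theorem det_add_exp_smul_conj_pos {ω s a b : ℝ} (hω : ω ≠ 0) (hs : 0 < s)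
    (ha : 0 ≤ a) (hb : 0 ≤ b) (F : Matrix (Fin 2) (Fin 2) ℝ) (t : ℝ) :
    0 < (!![s, 0; 0, ω ^ 2 * s] +
      NormedSpace.exp (t • F) * !![a, 0; 0, b] * NormedSpace.exp (t • Fᵀ)).det := by
  rw [← transpose_smul, Matrix.exp_transpose]
  set E := NormedSpace.exp (t • F)
  have h : (!![s, 0; 0, ω ^ 2 * s] + E * !![a, 0; 0, b] * Eᵀ).det =
      ω ^ 2 * s ^ 2 + s * (a * E 1 0 ^ 2 + b * E 1 1 ^ 2) +
        ω ^ 2 * s * (a * E 0 0 ^ 2 + b * E 0 1 ^ 2) + a * b * E.det ^ 2 := by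
    simp [det_fin_two, Matrix.mul_apply, Fin.sum_univ_two]
    ring
  rw [h]
  positivity

/-- Overdamped noisy harmonic oscillator (`γ² > 4ω²`): if both initial variances exceed the
stationary ones (`σ̄₁² > σ_*`, `σ̄₂² > ω²σ_*`), then `det Q(t)` is strictly decreasing on
`[0, ∞)`; equivalently the Gibbs entropy `H_G(t) = 1 + log(2π) + (1/2) log det Q(t)` is
strictly decreasing for all `t ≥ 0`. -/
theorem noisy_ho_overdamped_gibbs_decreasing (γ ω σ σ₁ σ₂ : ℝ)
    (hγ : 0 < γ) (hω : 0 < ω) (hσ : 0 < σ) (hσ₁ : 0 < σ₁) (hσ₂ : 0 < σ₂)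
    (hover : γ ^ 2 > 4 * ω ^ 2) :
    ∀ F Sg Q₀ : Matrix (Fin 2) (Fin 2) ℝ,
      F = !![0, 1; -ω ^ 2, -γ] → Sg = !![0, 0; 0, σ] → Q₀ = !![σ₁ ^ 2, 0; 0, σ₂ ^ 2] →
    ∀ R : ℝ → Matrix (Fin 2) (Fin 2) ℝ,
      R = (fun t => Matrix.of (fun i j =>
        ∫ s in (0 : ℝ)..t,
          (NormedSpace.exp (s • F) * (Sg * Sgᵀ) * NormedSpace.exp (s • Fᵀ)) i j)) →
    ∀ Q : ℝ → Matrix (Fin 2) (Fin 2) ℝ,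
      Q = (fun t => NormedSpace.exp (t • F) * Q₀ * NormedSpace.exp (t • Fᵀ) + R t) →
    ∀ sstar : ℝ, sstar = σ ^ 2 / (2 * γ * ω ^ 2) →
    σ₁ ^ 2 > sstar → σ₂ ^ 2 > ω ^ 2 * sstar →
      StrictAntiOn (fun t => (Q t).det) (Ici 0) ∧
        StrictAntiOn (fun t => 1 + Real.log (2 * Real.pi) + (1 / 2) * Real.log (Q t).det)
          (Ici 0) := by
  intro F Sg Q₀ hF hSg hQ₀ R hR Q hQ s hs ha hb
  have hs0 : 0 < s := by rw [hs]; positivity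
  have hsσ : σ ^ 2 = 2 * γ * ω ^ 2 * s := by rw [hs]; field_simp
  have hlyap : F * !![s, 0; 0, ω ^ 2 * s] + !![s, 0; 0, ω ^ 2 * s] * Fᵀ = -(Sg * Sgᵀ) := by
    ext i j
    fin_cases i <;> fin_cases j <;>
      simp [hF, hSg, Matrix.vecMul, dotProduct, Fin.sum_univ_two] <;> linarith
  have hQ' : Q = fun t => !![s, 0; 0, ω ^ 2 * s] + NormedSpace.exp (t • F) *
      !![σ₁ ^ 2 - s, 0; 0, σ₂ ^ 2 - ω ^ 2 * s] * NormedSpace.exp (t • Fᵀ) := by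
    have hD : !![σ₁ ^ 2 - s, 0; 0, σ₂ ^ 2 - ω ^ 2 * s] = Q₀ - !![s, 0; 0, ω ^ 2 * s] := by
      simp [hQ₀]
    have hRt (t : ℝ) : R t = !![s, 0; 0, ω ^ 2 * s] -
        NormedSpace.exp (t • F) * !![s, 0; 0, ω ^ 2 * s] * NormedSpace.exp (t • Fᵀ) := by
      rw [hR]
      ext i j
      exact integral_exp_smul_mul_mul_exp_smul_transpose_apply hlyap i j t
    funext t
    rw [hQ, hD]
    simp only [hRt]
    noncomm_ring
  have ha' : 0 < σ₁ ^ 2 - s := sub_pos.2 ha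
  have hb' : 0 < σ₂ ^ 2 - ω ^ 2 * s := sub_pos.2 hb
  have hpos (t : ℝ) : 0 < (Q t).det := by
    rw [hQ']
    exact det_add_exp_smul_conj_pos hω.ne' hs0 ha'.le hb'.le F t
  have hanti : StrictAnti (fun t => (Q t).det) := by
    rw [hQ']
    refine strictAnti_of_hasDerivAt_neg
      (fun t => hasDerivAt_det_add_exp_smul_conj γ ω s _ _ t hF) fun t => ?_
    have hdet : (NormedSpace.exp (t • F)).det ≠ 0 :=
      ((isUnit_iff_isUnit_det _).1 (isUnit_exp (t • F))).ne_zero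
    exact mul_neg_of_neg_of_pos (by linarith) (by positivity)
  refine ⟨hanti.strictAntiOn _, fun x _ y _ hxy => ?_⟩
  have hlog := Real.log_lt_log (hpos y) (hanti hxy)
  dsimp only
  linarith
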